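/- Let n be an odd positive integer having exactly two distinct prime factors p and q (both necessarily odd), and suppose d = n^2 + 1 is squarefree with d ≡ 2 (mod 4). If the class number of Q(√d) equals 4, then the ideal class group of Q(√d) is isomorphic to Z/2Z × Z/2Z (the Klein four-group). -/

import Mathlib

lemma small_norm_aux (n : ℤ) (hn : 1 ≤ n) (k : ℕ) : ∀ x y : ℤ, 0 ≤ x → 0 ≤ y → y.toNat ≤ k →
    |x ^ 2 - (n ^ 2 + 1) * y ^ 2| ≤ n →
    ∃ m : ℤ, m ∣ x ∧ m ∣ y ∧ |x ^ 2 - (n ^ 2 + 1) * y ^ 2| = m ^ 2 := by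
  induction k with
  | zero =>
    intro x y hx hy hk h
    have : y = 0 := by omega
    subst this
    exact ⟨x, dvd_rfl, dvd_zero _, by simp⟩
  | succ k ih =>
    intro x y hx hy hk h
    by_cases hy0 : y = 0
    · subst hy0
      exact ⟨x, dvd_rfl, dvd_zero _, by simp⟩
    have hy1 : 1 ≤ y := by omega
    obtain ⟨h1, h2⟩ := abs_le.mp h
    have h3 : n * y ≤ x := by
      by_contra hc
      have : x ≤ n * y - 1 := by omega
      have hny : n ≤ n * y := by nlinarith
      nlinarith
    have h4 : x < (n + 1) * y := by
      by_contra hc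
      push Not at hc
      have : ((n + 1) * y) ^ 2 ≤ x ^ 2 := by
        apply pow_le_pow_left₀ (by positivity) hc
      nlinarith [mul_pos (by linarith : 0 < n) (by positivity : 0 < y ^ 2), mul_le_mul_of_nonneg_left (by nlinarith : 1 ≤ y ^ 2) (by linarith : 0 ≤ n)]
    have key : (|(n ^ 2 + 1) * y - n * x|) ^ 2 - (n ^ 2 + 1) * (x - n * y) ^ 2
        = -(x ^ 2 - (n ^ 2 + 1) * y ^ 2) := by
      rw [sq_abs]; ring
    obtain ⟨m, hm1, hm2, hm3⟩ := ih |(n ^ 2 + 1) * y - n * x| (x - n * y) (abs_nonneg _)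
      (by linarith) (by
        have : x - n * y < y := by linarith
        omega) (by rw [key, abs_neg]; exact h)
    rw [key, abs_neg] at hm3
    rw [dvd_abs] at hm1
    refine ⟨m, ?_, ?_, hm3⟩
    · have : x = n * ((n ^ 2 + 1) * y - n * x) + (n ^ 2 + 1) * (x - n * y) := by ring
      rw [this]
      exact dvd_add (dvd_mul_of_dvd_right hm1 _) (dvd_mul_of_dvd_right hm2 _)
    · have : y = ((n ^ 2 + 1) * y - n * x) + n * (x - n * y) := by ring
      rw [this]
      exact dvd_add hm1 (dvd_mul_of_dvd_right hm2 _)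

lemma small_norm (n : ℤ) (hn : 1 ≤ n) (x y : ℤ)
    (h : |x ^ 2 - (n ^ 2 + 1) * y ^ 2| ≤ n) :
    ∃ m : ℤ, m ∣ x ∧ m ∣ y ∧ |x ^ 2 - (n ^ 2 + 1) * y ^ 2| = m ^ 2 := by
  have := small_norm_aux n hn _ |x| |y| (abs_nonneg _) (abs_nonneg _) le_rfl
    (by simpa only [sq_abs] using h)
  simpa only [sq_abs, dvd_abs] using this

section abstract_ring
variable {R : Type*} [CommRing R]

/-- The ideal `(k, 1 + s)`. -/
def IdA (s : R) (k : ℕ) : Ideal R := Ideal.span {(k : R), 1 + s}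

lemma IdA_mul (n : ℕ) (hn : Odd n) (s : R) (hs : s ^ 2 = (n : R) ^ 2 + 1) (k l : ℕ)
    (h : k * l ∣ n ^ 2) : IdA s k * IdA s l = IdA s (k * l) := by
  have hk : Odd k := Odd.of_dvd_nat hn.pow ((Dvd.intro _ rfl).trans h)
  obtain ⟨e, he⟩ := h
  have heR : (n : R) ^ 2 = k * l * e := by exact_mod_cast congrArg (Nat.cast : ℕ → R) he
  obtain ⟨c, hc⟩ := hk
  have hcR : (k : R) = 2 * c + 1 := by exact_mod_cast congrArg (Nat.cast : ℕ → R) hc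
  unfold IdA
  rw [Ideal.span_pair_mul_span_pair]
  apply le_antisymm
  · rw [Ideal.span_le]
    rintro z (rfl | rfl | rfl | rfl) <;> rw [SetLike.mem_coe, Ideal.mem_span_pair]
    · exact ⟨1, 0, by push_cast; ring⟩
    · exact ⟨0, k, by push_cast; ring⟩
    · exact ⟨0, l, by push_cast; ring⟩
    · exact ⟨0, 1 + s, by push_cast; ring⟩
  · rw [Ideal.span_le]
    have m1 : (k : R) * l ∈ Ideal.span {(k : R) * l, k * (1 + s), (1 + s) * l, (1 + s) * (1 + s)} :=
      Ideal.subset_span (by simp)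
    have m2 : (k : R) * (1 + s) ∈ Ideal.span {(k : R) * l, k * (1 + s), (1 + s) * l, (1 + s) * (1 + s)} :=
      Ideal.subset_span (by simp)
    have m4 : (1 + s) * (1 + s) ∈ Ideal.span {(k : R) * l, k * (1 + s), (1 + s) * l, (1 + s) * (1 + s)} :=
      Ideal.subset_span (by simp)
    rintro z (rfl | rfl) <;> rw [SetLike.mem_coe]
    · push_cast; exact m1
    · have : 1 + s = (k : R) * (1 + s) - c * ((1 + s) * (1 + s) - e * ((k : R) * l)) := by
        linear_combination (-(1 + s)) * hcR + c * hs + c * heR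
      have h := sub_mem m2 (Ideal.mul_mem_left _ (c : R) (sub_mem m4 (Ideal.mul_mem_left _ (e : R) m1)))
      rwa [← this] at h

lemma IdA_mul_conj (n : ℕ) (hn : Odd n) (s : R) (hs : s ^ 2 = (n : R) ^ 2 + 1) (k : ℕ)
    (h : k ∣ n) : IdA s k * IdA (-s) k = Ideal.span {(k : R)} := by
  have hk : Odd k := Odd.of_dvd_nat hn h
  obtain ⟨e, he⟩ := h
  have heR : (n : R) = k * e := by exact_mod_cast congrArg (Nat.cast : ℕ → R) he
  obtain ⟨c, hc⟩ := hk
  have hcR : (k : R) = 2 * c + 1 := by exact_mod_cast congrArg (Nat.cast : ℕ → R) hc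
  unfold IdA
  rw [Ideal.span_pair_mul_span_pair]
  apply le_antisymm
  · rw [Ideal.span_le]
    rintro z (rfl | rfl | rfl | rfl) <;> rw [SetLike.mem_coe, Ideal.mem_span_singleton]
    · exact ⟨k, by ring⟩
    · exact ⟨1 + -s, by ring⟩
    · exact ⟨1 + s, by ring⟩
    · exact ⟨-(k * e ^ 2), by linear_combination -hs - (n + k * e : R) * heR⟩
  · rw [Ideal.span_singleton_le_iff_mem]
    have : (k : R) = k * k - c * (k * (1 + -s) + (1 + s) * k) := by
      linear_combination (-(k : R)) * hcR
    have m1 : (k : R) * k ∈ Ideal.span {(k : R) * k, k * (1 + -s), (1 + s) * k, (1 + s) * (1 + -s)} :=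
      Ideal.subset_span (by simp)
    have m2 : (k : R) * (1 + -s) ∈ Ideal.span {(k : R) * k, k * (1 + -s), (1 + s) * k, (1 + s) * (1 + -s)} :=
      Ideal.subset_span (by simp)
    have m3 : (1 + s) * (k : R) ∈ Ideal.span {(k : R) * k, k * (1 + -s), (1 + s) * k, (1 + s) * (1 + -s)} :=
      Ideal.subset_span (by simp)
    have h := sub_mem m1 (Ideal.mul_mem_left _ (c : R) (add_mem m2 m3))
    rwa [← this] at h

lemma not_principal (n : ℕ) (hn : 0 < n) (s : R) (hs : s ^ 2 = (n : R) ^ 2 + 1)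
    (hrep : ∀ r : R, ∃ x y : ℤ, r = x + y * s)
    (hinj : ∀ x y z w : ℤ, (x + y * s : R) = z + w * s → x = z ∧ y = w)
    (k l : ℕ) (hkl : k.Coprime l) (hdv : k * l ∣ n)
    (hpr : (IdA s k * IdA (-s) l).IsPrincipal) : k = 1 ∧ l = 1 := by
  obtain ⟨θ, hθ⟩ := hpr
  rw [← Ideal.span] at hθ
  have mem : θ ∈ IdA s k * IdA (-s) l := by
    rw [hθ]; exact Ideal.mem_span_singleton_self θ
  have memk : θ ∈ Ideal.span {(k : R), 1 + s} :=
    (Ideal.mul_le_left : IdA s k * IdA (-s) l ≤ IdA s k) mem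
  have meml : θ ∈ Ideal.span {(l : R), 1 + -s} :=
    (Ideal.mul_le_right : IdA s k * IdA (-s) l ≤ IdA (-s) l) mem
  rw [IdA, IdA, Ideal.span_pair_mul_span_pair] at hθ
  have d1 : θ ∣ (k : R) * l := by
    rw [← Ideal.mem_span_singleton, ← hθ]; exact Ideal.subset_span (by simp)
  have d2 : θ ∣ (k : R) * (1 + -s) := by
    rw [← Ideal.mem_span_singleton, ← hθ]; exact Ideal.subset_span (by simp)
  have d3 : θ ∣ (1 + s) * (l : R) := by
    rw [← Ideal.mem_span_singleton, ← hθ]; exact Ideal.subset_span (by simp)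
  clear hθ mem
  obtain ⟨x, y, rfl⟩ := hrep θ
  obtain ⟨e, he⟩ := hdv
  have heZ : (n : ℤ) = k * l * e := by exact_mod_cast he
  have hnR : (n : R) = k * l * e := by exact_mod_cast congrArg (Nat.cast : ℕ → R) he
  -- `k ∣ N`
  have kN : (k : ℤ) ∣ x ^ 2 - (n ^ 2 + 1) * y ^ 2 := by
    obtain ⟨u, v, huv⟩ := Ideal.mem_span_pair.mp memk
    obtain ⟨u1, u2, rfl⟩ := hrep u
    obtain ⟨v1, v2, rfl⟩ := hrep v
    obtain ⟨h1, h2⟩ := hinj (u1 * k + v1 + v2 * (n ^ 2 + 1)) (u2 * k + v1 + v2) x y (by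
      rw [← huv]; push_cast; linear_combination -(v2 : R) * hs)
    have h3 : (k : ℤ) ∣ x - y := ⟨u1 - u2 + v2 * (k * l ^ 2 * e ^ 2), by
      rw [← h1, ← h2, heZ]; ring⟩
    have : x ^ 2 - ((n : ℤ) ^ 2 + 1) * y ^ 2 = (x - y) * (x + y) - k * (k * l ^ 2 * e ^ 2 * y ^ 2) := by
      rw [heZ]; ring
    rw [this]
    exact dvd_sub (dvd_mul_of_dvd_left h3 _) (Dvd.intro _ rfl)
  have lN : (l : ℤ) ∣ x ^ 2 - (n ^ 2 + 1) * y ^ 2 := by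
    obtain ⟨u, v, huv⟩ := Ideal.mem_span_pair.mp meml
    obtain ⟨u1, u2, rfl⟩ := hrep u
    obtain ⟨v1, v2, rfl⟩ := hrep v
    obtain ⟨h1, h2⟩ := hinj (u1 * l + v1 - v2 * (n ^ 2 + 1)) (u2 * l - v1 + v2) x y (by
      rw [← huv]; push_cast; linear_combination (v2 : R) * hs)
    have h3 : (l : ℤ) ∣ x + y := ⟨u1 + u2 - v2 * (l * k ^ 2 * e ^ 2), by
      rw [← h1, ← h2, heZ]; ring⟩
    have : x ^ 2 - ((n : ℤ) ^ 2 + 1) * y ^ 2 = (x + y) * (x - y) - l * (l * k ^ 2 * e ^ 2 * y ^ 2) := by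
      rw [heZ]; ring
    rw [this]
    exact dvd_sub (dvd_mul_of_dvd_left h3 _) (Dvd.intro _ rfl)
  obtain ⟨a, ha⟩ := d1
  obtain ⟨b, hb⟩ := d2
  obtain ⟨c, hc⟩ := d3
  obtain ⟨a1, a2, rfl⟩ := hrep a
  obtain ⟨b1, b2, rfl⟩ := hrep b
  obtain ⟨c1, c2, rfl⟩ := hrep c
  obtain ⟨A1, A2⟩ := hinj (k * l) 0 (x * a1 + y * a2 * (n ^ 2 + 1)) (x * a2 + y * a1) (by
    push_cast; linear_combination ha + (y * a2 : R) * hs)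
  obtain ⟨B1, B2⟩ := hinj k (-k) (x * b1 + y * b2 * (n ^ 2 + 1)) (x * b2 + y * b1) (by
    push_cast; linear_combination hb + (y * b2 : R) * hs)
  obtain ⟨C1, C2⟩ := hinj l l (x * c1 + y * c2 * (n ^ 2 + 1)) (x * c2 + y * c1) (by
    push_cast; linear_combination hc + (y * c2 : R) * hs)
  have N1 : x ^ 2 - ((n : ℤ) ^ 2 + 1) * y ^ 2 ∣ (k : ℤ) * l * k := 
    ⟨a1 * b1 - (n ^ 2 + 1) * a2 * b2, by
      linear_combination (k : ℤ) * A1 + (x * a1 + y * a2 * ((n : ℤ) ^ 2 + 1)) * B1 - ((n : ℤ) ^ 2 + 1) * (x * b2 + y * b1) * A2⟩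
  have N2 : x ^ 2 - ((n : ℤ) ^ 2 + 1) * y ^ 2 ∣ (k : ℤ) * l * l := 
    ⟨a1 * c1 - (n ^ 2 + 1) * a2 * c2, by
      linear_combination (l : ℤ) * A1 + (x * a1 + y * a2 * ((n : ℤ) ^ 2 + 1)) * C1 - ((n : ℤ) ^ 2 + 1) * (x * c2 + y * c1) * A2⟩
  have hcop : IsCoprime (k : ℤ) (l : ℤ) := Nat.isCoprime_iff_coprime.mpr hkl
  have N3 : x ^ 2 - ((n : ℤ) ^ 2 + 1) * y ^ 2 ∣ (k : ℤ) * l := by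
    obtain ⟨f, g, hfg⟩ := hcop
    have : (k * l : ℤ) = f * (k * l * k) + g * (k * l * l) := by
      linear_combination -(k * l : ℤ) * hfg
    rw [this]
    exact dvd_add (dvd_mul_of_dvd_right N1 _) (dvd_mul_of_dvd_right N2 _)
  have hle : |x ^ 2 - ((n : ℤ) ^ 2 + 1) * y ^ 2| ≤ (n : ℤ) := by
    refine Int.le_of_dvd (by exact_mod_cast hn) ?_
    rw [abs_dvd]
    exact N3.trans ⟨e, heZ⟩
  obtain ⟨m, hm1, hm2, hm3⟩ := small_norm n (by exact_mod_cast hn) x y hle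
  have mk : m ∣ (k : ℤ) := by
    rw [B1]; exact dvd_add (dvd_mul_of_dvd_left hm1 _)
      (dvd_mul_of_dvd_left (dvd_mul_of_dvd_left hm2 _) _)
  have ml : m ∣ (l : ℤ) := by
    rw [C1]; exact dvd_add (dvd_mul_of_dvd_left hm1 _)
      (dvd_mul_of_dvd_left (dvd_mul_of_dvd_left hm2 _) _)
  have mu : IsUnit m := hcop.isUnit_of_dvd' mk ml
  have Nu : IsUnit (x ^ 2 - ((n : ℤ) ^ 2 + 1) * y ^ 2) := by
    rw [Int.isUnit_iff_abs_eq, hm3]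
    rcases Int.isUnit_iff.mp mu with h | h <;> rw [h] <;> norm_num
  constructor
  · have := isUnit_of_dvd_unit kN Nu
    rcases Int.isUnit_iff.mp this with h | h <;> omega
  · have := isUnit_of_dvd_unit lN Nu
    rcases Int.isUnit_iff.mp this with h | h <;> omega

open scoped nonZeroDivisors

open Classical in
/-- The class of `(k, 1 + s)`. -/
noncomputable def clsA [IsDedekindDomain R] (s : R) (k : ℕ) : ClassGroup R :=
  if h : IdA s k ∈ (Ideal R)⁰ then ClassGroup.mk0 ⟨IdA s k, h⟩ else 1

lemma IdA_mem [IsDedekindDomain R] [CharZero R] (s : R) (k : ℕ) (hk : k ≠ 0) :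
    IdA s k ∈ (Ideal R)⁰ := by
  rw [mem_nonZeroDivisors_iff_ne_zero]
  intro h
  have : (k : R) ∈ IdA s k := Ideal.subset_span (by simp)
  rw [h] at this
  exact hk (by exact_mod_cast (Submodule.mem_bot R).mp this)

lemma clsA_eq [IsDedekindDomain R] [CharZero R] (s : R) (k : ℕ) (hk : k ≠ 0) :
    clsA s k = ClassGroup.mk0 ⟨IdA s k, IdA_mem s k hk⟩ := by
  rw [clsA, dif_pos]

lemma clsA_mul [IsDedekindDomain R] [CharZero R] (n : ℕ) (hn : Odd n) (s : R)
    (hs : s ^ 2 = (n : R) ^ 2 + 1) (k l : ℕ)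
    (h : k * l ∣ n ^ 2) : clsA s (k * l) = clsA s k * clsA s l := by
  have h0 : k * l ≠ 0 := by
    rintro h0
    rw [h0, zero_dvd_iff] at h
    have : n = 0 := by simpa using h
    subst this
    simp at hn
  have hk : k ≠ 0 := left_ne_zero_of_mul h0
  have hl : l ≠ 0 := right_ne_zero_of_mul h0
  rw [clsA_eq s _ h0, clsA_eq s _ hk, clsA_eq s _ hl, ← map_mul]
  congr 1
  apply Subtype.ext
  exact (IdA_mul n hn s hs k l h).symm

lemma clsA_inj [IsDedekindDomain R] [CharZero R] (n : ℕ) (hn : Odd n) (s : R)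
    (hs : s ^ 2 = (n : R) ^ 2 + 1)
    (hrep : ∀ r : R, ∃ x y : ℤ, r = x + y * s)
    (hinj : ∀ x y z w : ℤ, (x + y * s : R) = z + w * s → x = z ∧ y = w)
    (k l : ℕ) (hkl : k.Coprime l) (hdv : k * l ∣ n) (h : clsA s k = clsA s l) :
    k = 1 ∧ l = 1 := by
  have h0 : k * l ≠ 0 := by
    rintro h0
    rw [h0, zero_dvd_iff] at hdv
    subst hdv
    simp at hn
  have hk : k ≠ 0 := left_ne_zero_of_mul h0
  have hl : l ≠ 0 := right_ne_zero_of_mul h0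
  have hconj : clsA s l * clsA (-s) l = 1 := by
    rw [clsA_eq s _ hl, clsA_eq (-s) _ hl, ← map_mul]
    refine (ClassGroup.mk0_eq_one_iff (mul_mem (IdA_mem s l hl) (IdA_mem (-s) l hl))).mpr ?_
    rw [IdA_mul_conj n hn s hs l ((Dvd.intro_left _ rfl).trans hdv)]
    exact ⟨⟨_, rfl⟩⟩
  rw [← h, clsA_eq s _ hk, clsA_eq (-s) _ hl, ← map_mul] at hconj
  exact not_principal n hn.pos s hs hrep hinj k l hkl hdv
    ((ClassGroup.mk0_eq_one_iff (mul_mem (IdA_mem s k hk) (IdA_mem (-s) l hl))).mp hconj)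

lemma clsA_sq [IsDedekindDomain R] [CharZero R] (n : ℕ) (hn : Odd n) (s : R)
    (hs : s ^ 2 = (n : R) ^ 2 + 1) : clsA s (n ^ 2) = 1 := by
  have hn0 : n ^ 2 ≠ 0 := pow_ne_zero _ hn.pos.ne'
  rw [clsA_eq s _ hn0, ClassGroup.mk0_eq_one_iff]
  have : IdA s (n ^ 2) = Ideal.span {1 + s} := by
    apply le_antisymm
    · rw [IdA, Ideal.span_le]
      rintro z (rfl | rfl) <;> rw [SetLike.mem_coe, Ideal.mem_span_singleton]
      exact ⟨s - 1, by push_cast; linear_combination -hs⟩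
    · exact Ideal.span_mono (by simp)
  rw [this]
  exact ⟨⟨_, rfl⟩⟩

end abstract_ring

lemma group_four {G : Type*} [CommGroup G] (hG : Nat.card G = 4) (x y : G) (a b : ℕ)
    (ha : 1 ≤ a) (hb : 1 ≤ b)
    (hne : ∀ u v, u ≤ a → v ≤ b → x ^ u * y ^ v = 1 → u = 0 ∧ v = 0)
    (hxy : x ≠ y) (h2 : x ^ (2 * a) * y ^ (2 * b) = 1) (g : G) : g ^ 2 = 1 := by
  classical
  by_contra hg
  have h4 : ∀ z : G, z ^ 4 = 1 := fun z => by rw [← hG]; exact pow_card_eq_one'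
  have ho : orderOf g = 4 := by
    have : orderOf g = 2 ^ (1 + 1) := by
      have : Fact (Nat.Prime 2) := ⟨Nat.prime_two⟩
      exact orderOf_eq_prime_pow (by simpa using hg) (by simpa using h4 g)
    simpa using this
  have : Finite G := Nat.finite_of_card_ne_zero (by omega)
  have hgen : ∀ z : G, ∃ i < 4, z = g ^ i := by
    intro z
    have htop : Subgroup.zpowers g = ⊤ := by
      rw [← Subgroup.card_eq_iff_eq_top, Nat.card_zpowers, ho, hG]
    have hz : z ∈ Subgroup.zpowers g := by rw [htop]; trivial
    rw [← mem_powers_iff_mem_zpowers, mem_powers_iff_mem_range_orderOf] at hz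
    obtain ⟨i, hi, rfl⟩ := Finset.mem_image.mp hz
    exact ⟨i, by rw [Finset.mem_range, ho] at hi; exact hi, rfl⟩
  obtain ⟨i, hi, rfl⟩ := hgen x
  obtain ⟨j, hj, rfl⟩ := hgen y
  have ha4 : a < 4 := by
    by_contra hc
    have := hne 4 0 (by omega) (by omega) (by rw [h4]; simp)
    omega
  have hb4 : b < 4 := by
    by_contra hc
    have := hne 0 4 (by omega) (by omega) (by rw [h4]; simp)
    omega
  have hij : i ≠ j := by rintro rfl; exact hxy rfl
  simp only [← pow_mul, ← pow_add, ← orderOf_dvd_iff_pow_eq_one, ho] at hne h2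
  have e1 := hne 1 0 ha (by omega)
  have e2 := hne 0 1 (by omega) hb
  have e3 := hne 1 1 ha hb
  have e4 := hne a b le_rfl le_rfl
  have e5 := hne 2 0
  have e6 := hne 0 2
  clear hne hG h4 hgen hxy hg ho
  interval_cases a <;> interval_cases b <;> interval_cases i <;> interval_cases j <;> omega

lemma half_ints (d : ℕ) (hsf : Squarefree d) (hmod : d % 4 = 2) (x y : ℚ) (t N : ℤ)
    (ht : 2 * x = t) (hN : x ^ 2 - d * y ^ 2 = N) : ∃ a b : ℤ, x = a ∧ y = b := by
  set w : ℚ := 2 * y with hw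
  have h1 : (d : ℚ) * w ^ 2 = ((t ^ 2 - 4 * N : ℤ) : ℚ) := by
    push_cast; rw [← ht, ← hN, hw]; ring
  have hden : w.den = 1 := by
    have h2 : (d : ℤ) * w.num ^ 2 = (t ^ 2 - 4 * N) * (w.den : ℤ) ^ 2 := by
      have hw0 : (w.den : ℚ) ≠ 0 := by exact_mod_cast w.den_ne_zero
      have h3 : (w.num : ℚ) = w * w.den := (Rat.mul_den_eq_num w).symm
      have : ((d : ℚ)) * (w.num : ℚ) ^ 2 = ((t ^ 2 - 4 * N : ℤ) : ℚ) * (w.den : ℚ) ^ 2 := by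
        rw [h3, ← h1]; ring
      exact_mod_cast this
    have h4 : (w.den : ℤ) ^ 2 ∣ d * w.num ^ 2 := ⟨t ^ 2 - 4 * N, by rw [h2, mul_comm]⟩
    have h5 : IsCoprime ((w.den : ℤ) ^ 2) (w.num ^ 2) := by
      apply IsCoprime.pow
      rw [Int.isCoprime_iff_nat_coprime]
      simpa using w.reduced.symm
    have h6 := h5.dvd_of_dvd_mul_right h4
    have h7 : w.den * w.den ∣ d := by rw [← pow_two]; exact_mod_cast h6
    exact Nat.isUnit_iff.mp (hsf _ h7)
  have hwz : w = (w.num : ℚ) := (Rat.den_eq_one_iff w).mp hden |>.symm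
  set v := w.num
  have h8 : (d : ℤ) * v ^ 2 = t ^ 2 - 4 * N := by
    rw [hwz] at h1; exact_mod_cast h1
  obtain ⟨e, he⟩ : ∃ e : ℤ, (d : ℤ) = 4 * e + 2 := ⟨(d : ℤ) / 4, by omega⟩
  rw [he] at h8
  have ht2 : Even t := by
    rw [← Int.even_pow' (n := 2) two_ne_zero]
    exact ⟨(2 * e + 1) * v ^ 2 + 2 * N, by linarith⟩
  obtain ⟨a, ha⟩ := ht2
  have hv2 : Even v := by
    rw [← Int.even_pow' (n := 2) two_ne_zero]
    refine ⟨a ^ 2 - N - e * v ^ 2, ?_⟩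
    rw [ha] at h8
    linarith
  obtain ⟨b, hb⟩ := hv2
  refine ⟨a, b, ?_, ?_⟩
  · rw [ha] at ht; push_cast at ht; linarith
  · rw [hb] at hwz; push_cast at hwz; linarith

lemma not_sq (d : ℕ) (hmod : d % 4 = 2) (q : ℚ) : q ^ 2 ≠ d := by
  intro h
  have : IsSquare (d : ℚ) := ⟨q, by rw [← h]; ring⟩
  rw [Rat.isSquare_natCast_iff] at this
  obtain ⟨r, hr⟩ := this
  have h4 : r % 4 = 0 ∨ r % 4 = 1 ∨ r % 4 = 2 ∨ r % 4 = 3 := by omega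
  rw [hr, Nat.mul_mod] at hmod
  rcases h4 with h | h | h | h <;> rw [h] at hmod <;> omega

lemma ind_aux {K : Type} [Field K] [NumberField K] (d : ℕ) (hmod : d % 4 = 2)
    (α : K) (hα : α ^ 2 = (d : K)) (x y : ℚ) (h : (x : K) + y * α = 0) : x = 0 ∧ y = 0 := by
  have hy : y = 0 := by
    by_contra hy
    have hyK : (y : K) ≠ 0 := by exact_mod_cast hy
    have : α = ((-x / y : ℚ) : K) := by
      push_cast; field_simp; linear_combination h
    rw [this] at hα
    exact not_sq d hmod (-x / y) (by exact_mod_cast hα)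
  subst hy
  simp at h
  exact ⟨h, rfl⟩

lemma rep_int {K : Type} [Field K] [NumberField K] (d : ℕ) (hsf : Squarefree d) (hmod : d % 4 = 2)
    (hdeg : Module.finrank ℚ K = 2) (α : K) (hα : α ^ 2 = (d : K))
    (r : NumberField.RingOfIntegers K) : ∃ x y : ℤ, (r : K) = x + y * α := by
  have hli : LinearIndependent ℚ ![(1 : K), α] := by
    rw [LinearIndependent.pair_iff]
    intro x y h
    apply ind_aux d hmod α hα x y
    simpa [Algebra.smul_def] using h
  let b : Module.Basis (Fin 2) ℚ K := basisOfLinearIndependentOfCardEqFinrank hli (by simp [hdeg])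
  have hb0 : b 0 = 1 := by simp [b]
  have hb1 : b 1 = α := by simp [b]
  have hr := b.sum_repr (r : K)
  rw [Fin.sum_univ_two, hb0, hb1] at hr
  set x := b.repr (r : K) 0
  set y := b.repr (r : K) 1
  have e0 : (r : K) * b 0 = x • b 0 + y • b 1 := by rw [hb0, hb1, hr, mul_one]
  have e1 : (r : K) * b 1 = (y * d : ℚ) • b 0 + x • b 1 := by
    rw [hb0, hb1, ← hr]
    simp only [Algebra.smul_def, map_mul, map_natCast]
    linear_combination (algebraMap ℚ K y) * hα
  have hM : Algebra.leftMulMatrix b (r : K) = !![x, y * d; y, x] := by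
    ext i j
    rw [Algebra.leftMulMatrix_eq_repr_mul]
    fin_cases j
    · simp only [Fin.zero_eta, e0]
      fin_cases i <;> simp
    · simp only [Fin.mk_one, e1]
      fin_cases i <;> simp
  have htr : Algebra.trace ℚ K (r : K) = 2 * x := by
    rw [Algebra.trace_eq_matrix_trace b, hM, Matrix.trace_fin_two_of]; ring
  have hno : Algebra.norm ℚ (r : K) = x ^ 2 - d * y ^ 2 := by
    rw [Algebra.norm_eq_matrix_det b, hM, Matrix.det_fin_two_of]; ring
  rw [← Algebra.coe_trace_int] at htr
  rw [← Algebra.coe_norm_int] at hno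
  obtain ⟨u, v, hu, hv⟩ := half_ints d hsf hmod x y _ _ htr.symm hno.symm
  refine ⟨u, v, ?_⟩
  rw [← hr, hu, hv]
  simp [Algebra.smul_def]

theorem class_group_klein_of_odd_two_prime_factors
    (n : ℕ) (hn : 0 < n) (hnodd : Odd n)
    (p q : ℕ) (hp : p.Prime) (hq : q.Prime) (hpq : p ≠ q)
    (hfac : n.primeFactors = {p, q})
    (d : ℕ) (hd : d = n ^ 2 + 1) (hsf : Squarefree d) (hmod : d % 4 = 2)
    (K : Type) [Field K] [NumberField K]
    (hdeg : Module.finrank ℚ K = 2) (α : K) (hα : α ^ 2 = (d : K))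
    (hcl : NumberField.classNumber K = 4) :
    Nonempty (ClassGroup (NumberField.RingOfIntegers K) ≃*
      (Multiplicative (ZMod 2) × Multiplicative (ZMod 2))) := by
  have hαint : IsIntegral ℤ α := by
    apply IsIntegral.of_pow (n := 2) (by norm_num)
    rw [hα]
    exact_mod_cast isIntegral_algebraMap (R := ℤ) (A := K) (x := (d : ℤ))
  let s : NumberField.RingOfIntegers K := ⟨α, hαint⟩
  have hsα : (s : K) = α := rfl
  have hs : s ^ 2 = (n : NumberField.RingOfIntegers K) ^ 2 + 1 := by
    apply NumberField.RingOfIntegers.ext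
    simp only [map_pow, map_add, map_natCast, map_one]
    change α ^ 2 = _
    rw [hα, hd]
    push_cast; rfl
  have hrep : ∀ r : NumberField.RingOfIntegers K, ∃ x y : ℤ, r = x + y * s := by
    intro r
    obtain ⟨x, y, h⟩ := rep_int d hsf hmod hdeg α hα r
    refine ⟨x, y, NumberField.RingOfIntegers.ext ?_⟩
    rw [h]
    simp [hsα]
  have hinj : ∀ x y z w : ℤ, (x + y * s : NumberField.RingOfIntegers K) = z + w * s →
      x = z ∧ y = w := by
    intro x y z w h
    have h1 := congrArg (algebraMap (NumberField.RingOfIntegers K) K) h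
    simp only [map_add, map_mul, map_intCast] at h1
    change (x + y * α : K) = z + w * α at h1
    have := ind_aux d hmod α hα (x - z) (y - w) (by push_cast; linear_combination h1)
    exact ⟨by exact_mod_cast sub_eq_zero.mp this.1, by exact_mod_cast sub_eq_zero.mp this.2⟩
  have hcard : Nat.card (ClassGroup (NumberField.RingOfIntegers K)) = 4 := by
    rw [← hcl, NumberField.classNumber, Nat.card_eq_fintype_card]
  -- factorisation of `n`
  obtain ⟨a, b, ha, hb, hnab⟩ : ∃ a b : ℕ, 1 ≤ a ∧ 1 ≤ b ∧ n = p ^ a * q ^ b := by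
    have hpn : p ∈ n.primeFactors := by rw [hfac]; simp
    have hqn : q ∈ n.primeFactors := by rw [hfac]; simp
    refine ⟨n.factorization p, n.factorization q, ?_, ?_, ?_⟩
    · exact (hp.factorization_pos_of_dvd hn.ne' (Nat.dvd_of_mem_primeFactors hpn))
    · exact (hq.factorization_pos_of_dvd hn.ne' (Nat.dvd_of_mem_primeFactors hqn))
    · conv_lhs => rw [← Nat.prod_factorization_pow_eq_self hn.ne']
      rw [Finsupp.prod, Nat.support_factorization, hfac, Finset.prod_pair hpq]
  have hcpq : p.Coprime q := (Nat.coprime_primes hp hq).mpr hpq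
  have hone : clsA s 1 = 1 := by
    have := clsA_mul n hnodd s hs 1 1 (by simp)
    simpa using this
  have hpu : ∀ u ≤ 2 * a, clsA s (p ^ u) = clsA s p ^ u := by
    intro u
    induction u with
    | zero => intro _; simpa using hone
    | succ u ih =>
      intro hu
      rw [pow_succ, clsA_mul n hnodd s hs, ih (by omega), pow_succ]
      rw [← pow_succ, hnab, mul_pow, ← pow_mul, ← pow_mul]
      exact dvd_mul_of_dvd_left (pow_dvd_pow _ (by omega)) _
  have hqu : ∀ u ≤ 2 * b, clsA s (q ^ u) = clsA s q ^ u := by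
    intro u
    induction u with
    | zero => intro _; simpa using hone
    | succ u ih =>
      intro hu
      rw [pow_succ, clsA_mul n hnodd s hs, ih (by omega), pow_succ]
      rw [← pow_succ, hnab, mul_pow, ← pow_mul, ← pow_mul]
      exact dvd_mul_of_dvd_right (pow_dvd_pow _ (by omega)) _
  have hpquv : ∀ u v, u ≤ 2 * a → v ≤ 2 * b →
      clsA s (p ^ u * q ^ v) = clsA s p ^ u * clsA s q ^ v := by
    intro u v hu hv
    rw [clsA_mul n hnodd s hs, hpu u hu, hqu v hv]
    rw [hnab, mul_pow, ← pow_mul, ← pow_mul]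
    exact mul_dvd_mul (pow_dvd_pow _ (by omega)) (pow_dvd_pow _ (by omega))
  have hsq : ∀ g : ClassGroup (NumberField.RingOfIntegers K), g ^ 2 = 1 := by
    refine group_four hcard (clsA s p) (clsA s q) a b ha hb ?_ ?_ ?_
    · intro u v hu hv h
      rw [← hpquv u v (by omega) (by omega), ← hone] at h
      have := (clsA_inj n hnodd s hs hrep hinj _ 1 (by simp) (by
        rw [mul_one, hnab]; exact mul_dvd_mul (pow_dvd_pow _ hu) (pow_dvd_pow _ hv)) h).1
      have h1 := Nat.eq_one_of_mul_eq_one_right this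
      have h2 := Nat.eq_one_of_mul_eq_one_left this
      rw [Nat.pow_eq_one] at h1 h2
      exact ⟨h1.resolve_left hp.one_lt.ne', h2.resolve_left hq.one_lt.ne'⟩
    · intro h
      have := (clsA_inj n hnodd s hs hrep hinj p q hcpq (by
        rw [hnab]; exact mul_dvd_mul (dvd_pow_self _ (by omega)) (dvd_pow_self _ (by omega))) h).1
      exact hp.one_lt.ne' this
    · rw [← hpquv _ _ le_rfl le_rfl, ← clsA_sq n hnodd s hs]
      congr 1
      rw [hnab]; ring
  have hexp : ∀ {G : Type} [Group G], Nat.card G = 4 → (∀ g : G, g ^ 2 = 1) → IsKleinFour G := by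
    intro G _ hG h
    refine ⟨hG, ?_⟩
    have h2 : Monoid.exponent G ∣ 2 := Monoid.exponent_dvd_of_forall_pow_eq_one h
    rcases (Nat.dvd_prime Nat.prime_two).mp h2 with h1 | h1
    · rw [Monoid.exp_eq_one_iff] at h1
      have := Nat.card_of_subsingleton (1 : G)
      omega
    · exact h1
  have := hexp hcard hsq
  have : IsKleinFour (Multiplicative (ZMod 2) × Multiplicative (ZMod 2)) :=
    hexp (by simp) (by decide)
  exact IsKleinFour.nonempty_mulEquiv
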